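/- There exists a universal constant c > 0 such that for all n ≥ 1, all ε with 1/n ≤ ε ≤ 1/2, and every subset A ⊆ L_mid with |A| = σ·2^n (σ > 0): Pr_{(x,y) ← D}[x ∈ A and y ∈ A] ≥ c·σ²/ln(1/ε). -/

import Mathlib

open Finset

/-- The Hamming weight `‖x‖₁` of `x ∈ {0,1}^n`. -/
def wt {n : ℕ} (x : Fin n → Bool) : ℕ :=
  (Finset.univ.filter (fun i => x i = true)).card

/-- The Hamming distance `‖x − y‖₁`. -/
def hamm {n : ℕ} (x y : Fin n → Bool) : ℕ :=
  (Finset.univ.filter (fun i => x i ≠ y i)).card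

/-- The parameter `d = d(n,ε) = 2⌈√(2n·ln(100/ε))⌉`. -/
noncomputable def dPar (n : ℕ) (ε : ℝ) : ℕ :=
  2 * ⌈Real.sqrt (2 * n * Real.log (100 / ε))⌉₊

open Classical in
/-- The middle layers `L_mid = {x : (n−d)/2 ≤ ‖x‖₁ ≤ (n+d)/2}`. -/
noncomputable def Lmid (n : ℕ) (ε : ℝ) : Finset (Fin n → Bool) :=
  Finset.univ.filter (fun x =>
    ((n : ℝ) - dPar n ε) / 2 ≤ (wt x : ℝ) ∧ (wt x : ℝ) ≤ ((n : ℝ) + dPar n ε) / 2)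

/-- The `j`-th point (from the bottom) of the path from `0^n` to `1^n` determined by the
permutation `π`: its ones are exactly in positions `π(0),…,π(j−1)`. -/
def pathPoint {n : ℕ} (π : Equiv.Perm (Fin n)) (j : ℕ) : Fin n → Bool :=
  fun i => decide ((π.symm i : ℕ) < j)

/-- The indices `j` of the points of the path `π` lying in the middle layers `L_mid`. -/
noncomputable def pmidIdx (n : ℕ) (ε : ℝ) (π : Equiv.Perm (Fin n)) : Finset ℕ :=
  (Finset.range (n + 1)).filter (fun j => pathPoint π j ∈ Lmid n ε)

/-- `Pr_{(x,y) ← D}[x ∈ A ∧ y ∈ A]`: pick a uniformly random path `π` from `0^n` to `1^n`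
(i.e. a uniformly random permutation), then pick `x, y` independently and uniformly from
the points of the path lying in `L_mid`. -/
noncomputable def prBothD (n : ℕ) (ε : ℝ) (A : Finset (Fin n → Bool)) : ℝ :=
  (∑ π : Equiv.Perm (Fin n),
      ((((pmidIdx n ε π).filter (fun j => pathPoint π j ∈ A)).card : ℝ) /
          ((pmidIdx n ε π).card : ℝ)) ^ 2) /
    (Fintype.card (Equiv.Perm (Fin n)) : ℝ)

lemma aux_cb (m : ℕ) : m.centralBinom ^ 2 * (2 * m + 1) ≤ 16 ^ m := by
  induction m with
  | zero => simp
  | succ k ih =>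
    have h := Nat.succ_mul_centralBinom_succ k
    have h2 : (k + 1) ^ 2 * ((k + 1).centralBinom ^ 2 * (2 * (k + 1) + 1)) ≤
        (k + 1) ^ 2 * 16 ^ (k + 1) := by
      calc (k + 1) ^ 2 * ((k + 1).centralBinom ^ 2 * (2 * (k + 1) + 1))
          = ((k + 1) * (k + 1).centralBinom) ^ 2 * (2 * k + 3) := by ring
        _ = (4 * (2 * k + 1) * (2 * k + 3)) * (k.centralBinom ^ 2 * (2 * k + 1)) := by
            rw [h]; ring
        _ ≤ (4 * (2 * k + 1) * (2 * k + 3)) * 16 ^ k := Nat.mul_le_mul_left _ ih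
        _ ≤ (16 * (k + 1) ^ 2) * 16 ^ k := by
            apply Nat.mul_le_mul_right
            nlinarith
        _ = (k + 1) ^ 2 * 16 ^ (k + 1) := by ring
    exact Nat.le_of_mul_le_mul_left h2 (by positivity)

lemma aux_mid (n : ℕ) : (n.choose (n / 2)) ^ 2 * n ≤ 4 ^ n := by
  rcases Nat.even_or_odd' n with ⟨m, rfl | rfl⟩
  · have h := aux_cb m
    rw [Nat.centralBinom_eq_two_mul_choose] at h
    have e : 2 * m / 2 = m := by omega
    rw [e, pow_mul]
    norm_num
    nlinarith [Nat.zero_le ((2 * m).choose m ^ 2)]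
  · have h := aux_cb (m + 1)
    rw [Nat.centralBinom_eq_two_mul_choose] at h
    have e : (2 * m + 1) / 2 = m := by omega
    have e2 : (2 * (m + 1)).choose (m + 1) = 2 * (2 * m + 1).choose m := by
      have : 2 * (m + 1) = (2 * m + 1) + 1 := by ring
      rw [this, Nat.choose_succ_succ, Nat.choose_symm_half]
      ring
    rw [e2] at h
    rw [e, pow_succ 4, pow_mul 4]
    norm_num only
    have h16 : (16 : ℕ) ^ (m + 1) = 16 * 16 ^ m := by ring
    rw [h16] at h
    nlinarith [Nat.zero_le ((2 * m + 1).choose m ^ 2)]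

lemma aux_wt_path {n : ℕ} (π : Equiv.Perm (Fin n)) (j : ℕ) (hj : j ≤ n) :
    wt (pathPoint π j) = j := by
  unfold wt pathPoint
  simp only [decide_eq_true_eq]
  have : (univ.filter (fun i => (π.symm i : ℕ) < j)).card
      = (univ.filter (fun i : Fin n => (i : ℕ) < j)).card := by
    apply Finset.card_bij (fun i _ => π.symm i)
    · intro a ha; simpa using ha
    · intro a _ b _ h; simpa using h
    · intro b hb; exact ⟨π b, by simpa using hb, by simp⟩
  rw [this, Fin.card_filter_val_lt]
  omega

lemma aux_wt_le {n : ℕ} (x : Fin n → Bool) : wt x ≤ n := by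
  unfold wt
  simpa using Finset.card_le_univ (univ.filter (fun i => x i = true))

lemma aux_count {n : ℕ} (x : Fin n → Bool) :
    (univ.filter (fun π : Equiv.Perm (Fin n) => pathPoint π (wt x) = x)).card
      = (wt x).factorial * (n - wt x).factorial := by
  have h := Numbering.card_prefixed (univ.filter (fun i => x i = true))
  rw [Fintype.card_fin] at h
  change _ = (wt x).factorial * (n - wt x).factorial at h
  rw [← h]
  have hc : n = Fintype.card (Fin n) := (Fintype.card_fin n).symm
  apply Finset.card_bij (fun π _ => π.symm.trans (finCongr hc))
  · intro π hπ
    simp only [mem_filter, mem_univ, true_and] at hπ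
    rw [Numbering.mem_prefixed]
    intro i
    have := congrFun hπ i
    simp only [pathPoint] at this
    change _ ↔ (π.symm i : ℕ) < wt x
    rw [← decide_eq_true_iff (p := (π.symm i : ℕ) < wt x), this]
    simp
  · intro a _ b _ hab
    have : a.symm = b.symm := by
      ext i
      have := congrArg (fun e => ((e i : Fin _) : ℕ)) hab
      simpa using this
    simpa using congrArg Equiv.symm this
  · intro f hf
    rw [Numbering.mem_prefixed] at hf
    refine ⟨(f.trans (finCongr hc.symm)).symm, ?_, ?_⟩
    · simp only [mem_filter, mem_univ, true_and]
      funext i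
      have := hf i
      simp only [mem_filter, mem_univ, true_and] at this
      change x i = true ↔ (f i : ℕ) < wt x at this
      simp only [pathPoint]
      rw [Bool.eq_iff_iff, this]
      simp
    · ext i; simp

lemma aux_sum (n : ℕ) (ε : ℝ) (A : Finset (Fin n → Bool)) (hA : A ⊆ Lmid n ε) :
    A.card * n.factorial ≤
      (∑ π : Equiv.Perm (Fin n), ((pmidIdx n ε π).filter (fun j => pathPoint π j ∈ A)).card)
        * n.choose (n / 2) := by
  have h1 : ∀ π : Equiv.Perm (Fin n), (A.filter (fun x => pathPoint π (wt x) = x)).card ≤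
      ((pmidIdx n ε π).filter (fun j => pathPoint π j ∈ A)).card := by
    intro π
    apply Finset.card_le_card_of_injOn wt
    · intro x hx
      simp only [coe_filter, Set.mem_setOf_eq] at hx
      simp only [coe_filter, Set.mem_setOf_eq, pmidIdx, mem_filter, mem_range]
      rw [hx.2]
      exact ⟨⟨by have := aux_wt_le x; omega, hA hx.1⟩, hx.1⟩
    · intro x hx y hy hxy
      simp only [coe_filter, Set.mem_setOf_eq] at hx hy
      rw [← hx.2, ← hy.2, hxy]
  have h2 : (∑ π : Equiv.Perm (Fin n), (A.filter (fun x => pathPoint π (wt x) = x)).card)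
      = ∑ x ∈ A, (wt x).factorial * (n - wt x).factorial := by
    simp only [← aux_count]
    simp only [Finset.card_filter]
    exact Finset.sum_comm
  calc A.card * n.factorial
      = ∑ x ∈ A, n.factorial := by simp
    _ ≤ ∑ x ∈ A, ((wt x).factorial * (n - wt x).factorial) * n.choose (n / 2) := by
        apply Finset.sum_le_sum
        intro x _
        rw [← Nat.choose_mul_factorial_mul_factorial (aux_wt_le x), mul_assoc, mul_comm]
        exact Nat.mul_le_mul_left _ (Nat.choose_le_middle _ _)
    _ = (∑ x ∈ A, ((wt x).factorial * (n - wt x).factorial)) * n.choose (n / 2) := by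
        rw [Finset.sum_mul]
    _ ≤ _ := by
        rw [← h2]
        exact Nat.mul_le_mul_right _ (Finset.sum_le_sum fun π _ => h1 π)

lemma aux_pmid (n : ℕ) (ε : ℝ) (π : Equiv.Perm (Fin n)) :
    (pmidIdx n ε π).card ≤ dPar n ε + 1 := by
  obtain ⟨r, hr⟩ : ∃ r, dPar n ε = 2 * r := ⟨_, rfl⟩
  have hs : pmidIdx n ε π ⊆ Finset.Icc ((n + 1) / 2 - r) (n / 2 + r) := by
    intro j hj
    simp only [pmidIdx, mem_filter, mem_range, Lmid, mem_univ, true_and] at hj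
    obtain ⟨hjn, h1, h2⟩ := hj
    rw [aux_wt_path π j (by omega), hr] at h1 h2
    have h1' : n ≤ 2 * j + 2 * r := by
      have : (n : ℝ) ≤ ((2 * j + 2 * r : ℕ) : ℝ) := by push_cast at *; linarith
      exact_mod_cast this
    have h2' : 2 * j ≤ n + 2 * r := by
      have : ((2 * j : ℕ) : ℝ) ≤ ((n + 2 * r : ℕ) : ℝ) := by push_cast at *; linarith
      exact_mod_cast this
    rw [Finset.mem_Icc]
    omega
  have := Finset.card_le_card hs
  rw [Nat.card_Icc] at this
  omega

lemma aux_d (n : ℕ) (hn : 1 ≤ n) (ε : ℝ) (h0 : 0 < ε) (h : ε ≤ 1 / 2) :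
    ((dPar n ε : ℝ) + 1) ^ 2 ≤ 144 * (n * Real.log (1 / ε)) := by
  set L := Real.log (1 / ε) with hL
  have hL2 : Real.log 2 ≤ L := by
    apply Real.log_le_log (by norm_num)
    rw [le_div_iff₀ h0]; linarith
  have hl2 := Real.log_two_gt_d9
  have h100 : Real.log (100 / ε) ≤ 8 * L := by
    have e : (100 : ℝ) / ε = 100 * (1 / ε) := by ring
    rw [e, Real.log_mul (by norm_num) (by positivity)]
    have : Real.log 100 ≤ 7 * Real.log 2 := by
      have : (7 : ℝ) * Real.log 2 = Real.log (2 ^ 7) := by rw [Real.log_pow]; norm_num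
      rw [this]
      exact Real.log_le_log (by norm_num) (by norm_num)
    linarith
  have hn' : (1 : ℝ) ≤ n := by exact_mod_cast hn
  have hnL : (0.64 : ℝ) ≤ n * L := by nlinarith
  set s := Real.sqrt (n * L) with hs
  have hss : s ^ 2 = n * L := Real.sq_sqrt (by linarith)
  have hs8 : (0.8 : ℝ) ≤ s := by
    apply Real.le_sqrt_of_sq_le; norm_num at hnL ⊢; linarith
  have hq : Real.sqrt (2 * n * Real.log (100 / ε)) ≤ 4 * s := by
    apply Real.sqrt_le_iff.2
    constructor
    · linarith
    · rw [mul_pow, hss]; nlinarith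
  have hc := Nat.ceil_lt_add_one (Real.sqrt_nonneg (2 * n * Real.log (100 / ε)))
  have hd : (dPar n ε : ℝ) + 1 ≤ 12 * s := by
    unfold dPar
    push_cast
    linarith
  calc ((dPar n ε : ℝ) + 1) ^ 2 ≤ (12 * s) ^ 2 := by
        apply pow_le_pow_left₀ (by positivity) hd
    _ = _ := by rw [mul_pow, hss]; norm_num

theorem prob_both_in_A_under_D :
    ∃ c : ℝ, 0 < c ∧ ∀ n : ℕ, 1 ≤ n → ∀ ε : ℝ, 1 / (n : ℝ) ≤ ε → ε ≤ 1 / 2 →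
      ∀ A : Finset (Fin n → Bool), A ⊆ Lmid n ε → ∀ σ : ℝ, 0 < σ →
        (A.card : ℝ) = σ * 2 ^ n →
        c * σ ^ 2 / Real.log (1 / ε) ≤ prBothD n ε A := by
  refine ⟨1 / 144, by norm_num, ?_⟩
  intro n hn ε hε1 hε2 A hA σ hσ hcard
  have hn' : (1 : ℝ) ≤ n := by exact_mod_cast hn
  have h0 : 0 < ε := lt_of_lt_of_le (by positivity) hε1
  have hd := aux_d n hn ε h0 hε2
  have hLpos : 0 < Real.log (1 / ε) := by
    apply Real.log_pos
    rw [lt_div_iff₀ h0]; linarith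
  set L := Real.log (1 / ε) with hL
  set D : ℝ := (dPar n ε : ℝ) + 1 with hD
  have hDpos : 0 < D := by positivity
  set N : Equiv.Perm (Fin n) → ℝ := fun π =>
    (((pmidIdx n ε π).filter (fun j => pathPoint π j ∈ A)).card : ℝ) with hN
  set F : ℝ := (n.factorial : ℝ) with hF
  have hFpos : 0 < F := by rw [hF]; exact_mod_cast n.factorial_pos
  set C : ℝ := (n.choose (n / 2) : ℝ) with hC
  have hCpos : 0 < C := by
    rw [hC]; exact_mod_cast Nat.choose_pos (Nat.div_le_self n 2)
  have hS : (A.card : ℝ) * F ≤ (∑ π, N π) * C := by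
    have := aux_sum n ε A hA
    have h2 : ((A.card * n.factorial : ℕ) : ℝ) ≤ _ := Nat.cast_le.2 this
    push_cast at h2
    exact h2
  have hmid : C ^ 2 * n ≤ (2 ^ n) ^ 2 := by
    have := aux_mid n
    have h2 : (((n.choose (n / 2)) ^ 2 * n : ℕ) : ℝ) ≤ ((4 ^ n : ℕ) : ℝ) := Nat.cast_le.2 this
    push_cast at h2
    rw [← pow_mul, mul_comm n 2, pow_mul]
    norm_num
    exact h2
  have hterm : ∀ π : Equiv.Perm (Fin n),
      (N π / D) ^ 2 ≤ (N π / ((pmidIdx n ε π).card : ℝ)) ^ 2 := by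
    intro π
    have hN0 : 0 ≤ N π := by simp [hN]
    apply pow_le_pow_left₀ (by positivity)
    rcases Nat.eq_zero_or_pos (pmidIdx n ε π).card with h | h
    · have : N π = 0 := by
        simp only [hN, Nat.cast_eq_zero]
        exact Nat.le_zero.1 (h ▸ Finset.card_filter_le _ _)
      simp [this]
    · apply div_le_div_of_nonneg_left hN0 (by exact_mod_cast h)
      rw [hD]
      exact_mod_cast aux_pmid n ε π
  have hcardP : (Fintype.card (Equiv.Perm (Fin n)) : ℝ) = F := by
    rw [Fintype.card_perm, Fintype.card_fin]
  have hCS : (∑ π, N π) ^ 2 ≤ F * ∑ π, N π ^ 2 := by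
    have := sq_sum_le_card_mul_sum_sq (s := (univ : Finset (Equiv.Perm (Fin n)))) (f := N)
    rwa [Finset.card_univ, hcardP] at this
  have hsum : (∑ π, N π ^ 2) / D ^ 2 ≤
      ∑ π : Equiv.Perm (Fin n), (N π / ((pmidIdx n ε π).card : ℝ)) ^ 2 := by
    rw [Finset.sum_div]
    apply Finset.sum_le_sum
    intro π _
    rw [← div_pow]
    exact hterm π
  have hlow : σ ^ 2 * n * F ≤ ∑ π, N π ^ 2 := by
    have h1 : (σ * 2 ^ n * F) ^ 2 ≤ ((∑ π, N π) * C) ^ 2 := by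
      rw [hcard] at hS
      exact pow_le_pow_left₀ (by positivity) hS 2
    have h2 : (σ ^ 2 * n * F) * (F * C ^ 2) ≤ (∑ π, N π ^ 2) * (F * C ^ 2) := by
      calc (σ ^ 2 * n * F) * (F * C ^ 2) = (σ * F) ^ 2 * (C ^ 2 * n) := by ring
        _ ≤ (σ * F) ^ 2 * (2 ^ n) ^ 2 := mul_le_mul_of_nonneg_left hmid (by positivity)
        _ = (σ * 2 ^ n * F) ^ 2 := by ring
        _ ≤ ((∑ π, N π) * C) ^ 2 := h1
        _ = (∑ π, N π) ^ 2 * C ^ 2 := by ring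
        _ ≤ (F * ∑ π, N π ^ 2) * C ^ 2 := mul_le_mul_of_nonneg_right hCS (by positivity)
        _ = _ := by ring
    exact le_of_mul_le_mul_right h2 (by positivity)
  unfold prBothD
  rw [hcardP, le_div_iff₀ hFpos]
  refine le_trans ?_ hsum
  rw [le_div_iff₀ (by positivity)]
  refine le_trans ?_ hlow
  calc 1 / 144 * σ ^ 2 / L * F * D ^ 2 ≤ 1 / 144 * σ ^ 2 / L * F * (144 * (n * L)) :=
        mul_le_mul_of_nonneg_left hd (by positivity)
    _ = σ ^ 2 * n * F := by field_simp
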